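/- Let ξ₁, ξ₂ ∈ Sym_d with ξ₁ ≠ ξ₂, and let V₁, V₂ ∈ L^p(Y; Sym_d) satisfy ∫_Y V_i(y) dy = 0 for i = 1,2 together with the orthogonality relations ∫_Y S(y, ξ_i + V_i(y)) : (V₁(y) − V₂(y)) dy = 0 for i = 1,2. Then the homogenized stress is strictly monotone at these points: (∫_Y S(y, ξ₁ + V₁(y)) dy − ∫_Y S(y, ξ₂ + V₂(y)) dy) : (ξ₁ − ξ₂) > 0. -/

import Mathlib

open MeasureTheory Filter Set Matrix

noncomputable section

/-- The unit cell `Y = (0,1]^d`. -/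
def Ycell (d : ℕ) : Set (EuclideanSpace ℝ (Fin d)) :=
  {y | ∀ i, y i ∈ Set.Ioc (0 : ℝ) 1}

/-- Frobenius inner product `A : B = Σ_{ij} a_{ij} b_{ij}` on `d×d` matrices. -/
def mdot {d : ℕ} (A B : Matrix (Fin d) (Fin d) ℝ) : ℝ :=
  ∑ i, ∑ j, A i j * B i j

/-- The Frobenius norm `|A| = √(A : A)`. -/
def mnorm {d : ℕ} (A : Matrix (Fin d) (Fin d) ℝ) : ℝ :=
  Real.sqrt (mdot A A)


lemma aux_abs_le {d : ℕ} (A : Matrix (Fin d) (Fin d) ℝ) (i j : Fin d) : |A i j| ≤ mnorm A := by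
  unfold mnorm mdot
  apply Real.abs_le_sqrt
  have h1 : A i j * A i j ≤ ∑ j, A i j * A i j :=
    Finset.single_le_sum (f := fun j => A i j * A i j) (fun j _ => mul_self_nonneg _) (Finset.mem_univ j)
  have h2 : ∑ j, A i j * A i j ≤ ∑ i, ∑ j, A i j * A i j :=
    Finset.single_le_sum (f := fun i => ∑ j, A i j * A i j)
      (fun i _ => Finset.sum_nonneg fun j _ => mul_self_nonneg _) (Finset.mem_univ i)
  rw [sq]
  exact h1.trans h2

lemma aux_mnorm_nonneg {d : ℕ} (A : Matrix (Fin d) (Fin d) ℝ) : 0 ≤ mnorm A := Real.sqrt_nonneg _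

lemma aux_le_sum {d : ℕ} (A : Matrix (Fin d) (Fin d) ℝ) : mnorm A ≤ ∑ i, ∑ j, |A i j| := by
  have h0 : 0 ≤ ∑ i, ∑ j, |A i j| :=
    Finset.sum_nonneg fun i _ => Finset.sum_nonneg fun j _ => abs_nonneg _
  unfold mnorm
  rw [Real.sqrt_le_left h0]
  unfold mdot
  have h2 : ∀ i j, |A i j| ≤ ∑ i, ∑ j, |A i j| := fun i j =>
    (Finset.single_le_sum (f := fun j => |A i j|) (fun j _ => abs_nonneg _) (Finset.mem_univ j)).trans
    (Finset.single_le_sum (f := fun i => ∑ j, |A i j|)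
      (fun i _ => Finset.sum_nonneg fun j _ => abs_nonneg _) (Finset.mem_univ i))
  rw [sq]
  nth_rw 1 [Finset.sum_mul]
  refine Finset.sum_le_sum fun i _ => ?_
  rw [Finset.sum_mul]
  refine Finset.sum_le_sum fun j _ => ?_
  rw [← abs_mul_abs_self]
  exact mul_le_mul_of_nonneg_left (h2 i j) (abs_nonneg _)

lemma aux_memLp {d : ℕ} {Ω : Type*} [MeasurableSpace Ω] {μ : Measure Ω} {q : ℝ} (hq : 0 < q)
    {F : Ω → Matrix (Fin d) (Fin d) ℝ} (hF : ∀ i j, AEStronglyMeasurable (fun y => F y i j) μ)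
    {b : Ω → ℝ} (hb : Integrable b μ) (hFb : ∀ y, mnorm (F y) ^ q ≤ b y) (i j : Fin d) :
    MemLp (fun y => F y i j) (ENNReal.ofReal q) μ := by
  rw [← integrable_norm_rpow_iff (hF i j) (by simpa using hq) (by simp)]
  rw [ENNReal.toReal_ofReal hq.le]
  refine hb.mono' ?_ ?_
  · exact ((hF i j).norm.aemeasurable.pow_const q).aestronglyMeasurable
  · refine ae_of_all _ fun y => ?_
    rw [Real.norm_of_nonneg (by positivity)]
    exact (Real.rpow_le_rpow (norm_nonneg _) (aux_abs_le (F y) i j) hq.le).trans (hFb y)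

lemma aux_mnorm_int {d : ℕ} {Ω : Type*} [MeasurableSpace Ω] {μ : Measure Ω} {q : ℝ} (hq : 0 < q)
    {F : Ω → Matrix (Fin d) (Fin d) ℝ}
    (hF : ∀ i j, MemLp (fun y => F y i j) (ENNReal.ofReal q) μ) :
    Integrable (fun y => mnorm (F y) ^ q) μ := by
  have hs : MemLp (fun y => ∑ i, ∑ j, |F y i j|) (ENNReal.ofReal q) μ :=
    memLp_finsetSum _ fun i _ => memLp_finsetSum _ fun j _ => (hF i j).norm
  have hm : AEMeasurable (fun y => mnorm (F y)) μ := by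
    unfold mnorm mdot
    refine Real.continuous_sqrt.measurable.comp_aemeasurable ?_
    refine Finset.aemeasurable_fun_sum _ fun i _ => Finset.aemeasurable_fun_sum _ fun j _ => ?_
    exact (hF i j).aestronglyMeasurable.aemeasurable.mul (hF i j).aestronglyMeasurable.aemeasurable
  have h : MemLp (fun y => mnorm (F y)) (ENNReal.ofReal q) μ := by
    refine hs.mono hm.aestronglyMeasurable (ae_of_all _ fun y => ?_)
    rw [Real.norm_of_nonneg (aux_mnorm_nonneg _)]
    exact (aux_le_sum _).trans (le_abs_self _)
  have := h.integrable_norm_rpow (by simpa using hq) (by simp)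
  rw [ENNReal.toReal_ofReal hq.le] at this
  refine this.congr (ae_of_all _ fun y => ?_)
  simp only [Real.norm_of_nonneg (aux_mnorm_nonneg _)]

lemma aux_carath {d : ℕ}
    (S : EuclideanSpace ℝ (Fin d) → Matrix (Fin d) (Fin d) ℝ → Matrix (Fin d) (Fin d) ℝ)
    (hS2a : ∀ (ξ : Matrix (Fin d) (Fin d) ℝ) (i j : Fin d),
      Measurable fun y => S y ξ i j)
    (hS2b : ∀ᵐ y : EuclideanSpace ℝ (Fin d), ∀ i j : Fin d,
      Continuous fun ξ => S y ξ i j)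
    (W : EuclideanSpace ℝ (Fin d) → Matrix (Fin d) (Fin d) ℝ)
    (hW : ∀ i j : Fin d, Measurable fun y => W y i j) (i j : Fin d) :
    AEStronglyMeasurable (fun y => S y (W y) i j) volume := by
  classical
  obtain ⟨N, hN, hNm, hN0⟩ := exists_measurable_superset_of_null (ae_iff.1 hS2b)
  let T : EuclideanSpace ℝ (Fin d) → (Fin d → Fin d → ℝ) → ℝ :=
    fun y ξ => if y ∈ N then 0 else S y (Matrix.of ξ) i j
  have hT1 : ∀ y, Continuous (T y) := by
    intro y
    by_cases hy : y ∈ N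
    · simp only [T, hy, if_true]; exact continuous_const
    · simp only [T, hy, if_false]
      have : ∀ i j : Fin d, Continuous fun ξ => S y ξ i j := by
        by_contra h
        exact hy (hN h)
      exact this i j
  have hT2 : ∀ ξ, StronglyMeasurable fun y => T y ξ := fun ξ =>
    (Measurable.ite hNm measurable_const (hS2a (Matrix.of ξ) i j)).stronglyMeasurable
  have hu : StronglyMeasurable (Function.uncurry fun ξ y => T y ξ) :=
    stronglyMeasurable_uncurry_of_continuous_of_stronglyMeasurable hT1 hT2
  have hWm : Measurable fun y => ((fun i j => W y i j : Fin d → Fin d → ℝ), y) :=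
    Measurable.prodMk (measurable_pi_lambda _ fun i => measurable_pi_lambda _ fun j => hW i j)
      measurable_id
  refine ⟨_, hu.comp_measurable hWm, ?_⟩
  have : ∀ᵐ y : EuclideanSpace ℝ (Fin d), y ∉ N := measure_eq_zero_iff_ae_notMem.1 hN0
  filter_upwards [this] with y hy
  simp only [Function.comp, Function.uncurry, T, hy, if_false]
  rfl

lemma aux_vol (d : ℕ) : volume (Ycell d) = 1 := by
  have h := (EuclideanSpace.volume_preserving_symm_measurableEquiv_toLp (Fin d)).symm
  have e : Ycell d = (MeasurableEquiv.toLp 2 (Fin d → ℝ)).symm ⁻¹' (Set.univ.pi fun _ => Set.Ioc (0:ℝ) 1) := by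
    ext y; simp [Ycell]
  rw [e, (EuclideanSpace.volume_preserving_symm_measurableEquiv_toLp (Fin d)).measure_preimage_equiv,
    Real.volume_pi_Ioc]
  simp

lemma aux_mdot_int {d : ℕ} {Ω : Type*} [MeasurableSpace Ω] {μ : Measure Ω}
    {F G : Ω → Matrix (Fin d) (Fin d) ℝ}
    (h : ∀ i j, Integrable (fun y => F y i j * G y i j) μ) :
    Integrable (fun y => mdot (F y) (G y)) μ :=
  integrable_finsetSum _ fun i _ => integrable_finsetSum _ fun j _ => h i j

lemma aux_mdot_sub {d : ℕ} (A B C : Matrix (Fin d) (Fin d) ℝ) :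
    mdot (A - B) C = mdot A C - mdot B C := by
  simp [mdot, sub_mul, Finset.sum_sub_distrib]

lemma aux_mdot_add {d : ℕ} (A B C : Matrix (Fin d) (Fin d) ℝ) :
    mdot A (B + C) = mdot A B + mdot A C := by
  simp [mdot, mul_add, Finset.sum_add_distrib]

lemma aux_mdot_integral {d : ℕ} {Ω : Type*} [MeasurableSpace Ω] {μ : Measure Ω}
    {F : Ω → Matrix (Fin d) (Fin d) ℝ} (ξ : Matrix (Fin d) (Fin d) ℝ)
    (h : ∀ i j, Integrable (fun y => F y i j) μ) :
    mdot (Matrix.of fun i j => ∫ y, F y i j ∂μ) ξ = ∫ y, mdot (F y) ξ ∂μ := by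
  unfold mdot
  refine Eq.symm ((integral_finsetSum (μ := μ) Finset.univ (f := fun i y => ∑ j, F y i j * ξ i j)
    fun i _ => integrable_finsetSum _ fun j _ => (h i j).mul_const _).trans ?_)
  refine Finset.sum_congr rfl fun i _ => ?_
  refine (integral_finsetSum (μ := μ) Finset.univ (f := fun j y => F y i j * ξ i j)
    fun j _ => (h i j).mul_const _).trans ?_
  refine Finset.sum_congr rfl fun j _ => ?_
  exact integral_mul_const (ξ i j) fun y => F y i j

/-- strict monotonicity of the homogenized stress: if `ξ₁ ≠ ξ₂` in
`Sym_d` and `V₁, V₂ ∈ L^p(Y; Sym_d)` have zero mean and satisfy the orthogonality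
relations `∫_Y S(y, ξ_i + V_i(y)) : (V₁(y) − V₂(y)) dy = 0`, `i = 1,2`, then
`(∫_Y S(y, ξ₁ + V₁) − ∫_Y S(y, ξ₂ + V₂)) : (ξ₁ − ξ₂) > 0`. -/
theorem stmt9 {d : ℕ} (hd : 1 ≤ d) (p p' c₁ ct₁ c₂ : ℝ)
    (hp : 1 < p) (hp' : p' = p / (p - 1))
    (hc₁ : 0 < c₁) (hct₁ : 0 < ct₁) (hc₂ : 0 < c₂)
    (S : EuclideanSpace ℝ (Fin d) → Matrix (Fin d) (Fin d) ℝ → Matrix (Fin d) (Fin d) ℝ)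
    -- (S2) Carathéodory
    (hS2a : ∀ (ξ : Matrix (Fin d) (Fin d) ℝ) (i j : Fin d),
      Measurable fun y => S y ξ i j)
    (hS2b : ∀ᵐ y : EuclideanSpace ℝ (Fin d), ∀ i j : Fin d,
      Continuous fun ξ => S y ξ i j)
    -- (S3) strict monotonicity
    (hS3 : ∀ᵐ y : EuclideanSpace ℝ (Fin d), ∀ ξ₁ ξ₂ : Matrix (Fin d) (Fin d) ℝ,
      ξ₁ ≠ ξ₂ → 0 < mdot (S y ξ₁ - S y ξ₂) (ξ₁ - ξ₂))
    -- (S4) coercivity and growth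
    (hS4a : ∀ (y : EuclideanSpace ℝ (Fin d)) (ξ : Matrix (Fin d) (Fin d) ℝ),
      c₁ * mnorm ξ ^ p - ct₁ ≤ mdot (S y ξ) ξ)
    (hS4b : ∀ (y : EuclideanSpace ℝ (Fin d)) (ξ : Matrix (Fin d) (Fin d) ℝ),
      mnorm (S y ξ) ^ p' ≤ c₂ * (mnorm ξ ^ p + 1))
    -- the two cell-problem data
    (ξ₁ ξ₂ : Matrix (Fin d) (Fin d) ℝ) (hξ₁ : ξ₁ᵀ = ξ₁) (hξ₂ : ξ₂ᵀ = ξ₂)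
    (hne : ξ₁ ≠ ξ₂)
    (V₁ V₂ : EuclideanSpace ℝ (Fin d) → Matrix (Fin d) (Fin d) ℝ)
    (hV₁meas : ∀ i j : Fin d, Measurable fun y => V₁ y i j)
    (hV₂meas : ∀ i j : Fin d, Measurable fun y => V₂ y i j)
    (hV₁sym : ∀ᵐ y ∂(volume.restrict (Ycell d)), (V₁ y)ᵀ = V₁ y)
    (hV₂sym : ∀ᵐ y ∂(volume.restrict (Ycell d)), (V₂ y)ᵀ = V₂ y)
    (hV₁Lp : IntegrableOn (fun y => mnorm (V₁ y) ^ p) (Ycell d))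
    (hV₂Lp : IntegrableOn (fun y => mnorm (V₂ y) ^ p) (Ycell d))
    (hV₁mean : ∀ i j : Fin d, ∫ y in Ycell d, V₁ y i j = 0)
    (hV₂mean : ∀ i j : Fin d, ∫ y in Ycell d, V₂ y i j = 0)
    (hOrth₁ : ∫ y in Ycell d, mdot (S y (ξ₁ + V₁ y)) (V₁ y - V₂ y) = 0)
    (hOrth₂ : ∫ y in Ycell d, mdot (S y (ξ₂ + V₂ y)) (V₁ y - V₂ y) = 0) :
    0 < mdot
      ((Matrix.of fun i j => ∫ y in Ycell d, S y (ξ₁ + V₁ y) i j) -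
        (Matrix.of fun i j => ∫ y in Ycell d, S y (ξ₂ + V₂ y) i j))
      (ξ₁ - ξ₂) := by
  have hp0 : 0 < p := by linarith
  have hpq : p.HolderConjugate p' := by
    rw [hp']; exact Real.HolderConjugate.conjExponent hp
  have hp'1 : 1 < p' := hpq.symm.lt
  have hp'0 : 0 < p' := by linarith
  set μ := (volume.restrict (Ycell d) : Measure (EuclideanSpace ℝ (Fin d))) with hμ
  have hfin : IsFiniteMeasure μ := ⟨by rw [hμ, Measure.restrict_apply_univ, aux_vol]; simp⟩
  have key : ∀ (ξ : Matrix (Fin d) (Fin d) ℝ)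
      (V : EuclideanSpace ℝ (Fin d) → Matrix (Fin d) (Fin d) ℝ),
      (∀ i j : Fin d, Measurable fun y => V y i j) →
      Integrable (fun y => mnorm (V y) ^ p) μ →
      (∀ i j, MemLp (fun y => V y i j) (ENNReal.ofReal p) μ) ∧
      (∀ i j, MemLp (fun y => S y (ξ + V y) i j) (ENNReal.ofReal p') μ) := by
    intro ξ V hV hVp
    have h1 : ∀ i j, MemLp (fun y => V y i j) (ENNReal.ofReal p) μ :=
      aux_memLp hp0 (fun i j => (hV i j).aestronglyMeasurable) hVp (fun y => le_rfl)
    refine ⟨h1, ?_⟩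
    have h2 : ∀ i j, MemLp (fun y => (ξ + V y) i j) (ENNReal.ofReal p) μ := fun i j =>
      (memLp_const (ξ i j)).add (h1 i j)
    have h3 := aux_mnorm_int hp0 h2
    refine aux_memLp hp'0 (F := fun y => S y (ξ + V y)) (fun i j => ?_)
      ((h3.add (integrable_const 1)).const_mul c₂) (fun y => hS4b y _)
    exact (aux_carath S hS2a hS2b (fun y => ξ + V y)
      (fun i j => (hV i j).const_add (ξ i j)) i j).restrict
  obtain ⟨hV1, hS1⟩ := key ξ₁ V₁ hV₁meas hV₁Lp
  obtain ⟨hV2, hS2⟩ := key ξ₂ V₂ hV₂meas hV₂Lp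
  have hconj : (ENNReal.ofReal p').HolderConjugate (ENNReal.ofReal p) :=
    hpq.symm.ennrealOfReal
  have hp1' : (1 : ENNReal) ≤ ENNReal.ofReal p' := by simpa using hp'1.le
  have hp1 : (1 : ENNReal) ≤ ENNReal.ofReal p := by simpa using hp.le
  have iS1 := fun i j => (hS1 i j).integrable hp1'
  have iS2 := fun i j => (hS2 i j).integrable hp1'
  have iV1 := fun i j => (hV1 i j).integrable hp1
  have iV2 := fun i j => (hV2 i j).integrable hp1
  have I1 : Integrable (fun y => mdot (S y (ξ₁ + V₁ y)) (V₁ y - V₂ y)) μ :=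
    aux_mdot_int fun i j => (hS1 i j).integrable_mul ((hV1 i j).sub (hV2 i j))
  have I2 : Integrable (fun y => mdot (S y (ξ₂ + V₂ y)) (V₁ y - V₂ y)) μ :=
    aux_mdot_int fun i j => (hS2 i j).integrable_mul ((hV1 i j).sub (hV2 i j))
  have J1 : Integrable (fun y => mdot (S y (ξ₁ + V₁ y)) (ξ₁ - ξ₂)) μ :=
    aux_mdot_int (G := fun _ => ξ₁ - ξ₂) fun i j => (iS1 i j).mul_const _
  have J2 : Integrable (fun y => mdot (S y (ξ₂ + V₂ y)) (ξ₁ - ξ₂)) μ :=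
    aux_mdot_int (G := fun _ => ξ₁ - ξ₂) fun i j => (iS2 i j).mul_const _
  let g : EuclideanSpace ℝ (Fin d) → ℝ := fun y =>
    mdot (S y (ξ₁ + V₁ y) - S y (ξ₂ + V₂ y)) ((ξ₁ + V₁ y) - (ξ₂ + V₂ y))
  have hg : g = fun y => (mdot (S y (ξ₁ + V₁ y)) (ξ₁ - ξ₂) - mdot (S y (ξ₂ + V₂ y)) (ξ₁ - ξ₂))
      + (mdot (S y (ξ₁ + V₁ y)) (V₁ y - V₂ y) - mdot (S y (ξ₂ + V₂ y)) (V₁ y - V₂ y)) := by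
    funext y
    simp only [g]
    rw [add_sub_add_comm, aux_mdot_sub, aux_mdot_add, aux_mdot_add]
    ring
  have Ig : Integrable g μ := by
    rw [hg]; exact (J1.sub J2).add (I1.sub I2)
  have hgint : ∫ y, g y ∂μ = mdot
      ((Matrix.of fun i j => ∫ y, S y (ξ₁ + V₁ y) i j ∂μ) -
        (Matrix.of fun i j => ∫ y, S y (ξ₂ + V₂ y) i j ∂μ))
      (ξ₁ - ξ₂) := by
    rw [aux_mdot_sub, aux_mdot_integral (F := fun y => S y (ξ₁ + V₁ y)) _ iS1,
      aux_mdot_integral (F := fun y => S y (ξ₂ + V₂ y)) _ iS2, hg]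
    refine (integral_add (J1.sub J2) (I1.sub I2)).trans ?_
    have e1 := integral_sub J1 J2
    have e2 := integral_sub I1 I2
    rw [hOrth₁, hOrth₂, sub_zero] at e2
    exact (congrArg₂ (· + ·) e1 e2).trans (add_zero _)
  rw [← hgint]
  have hS3' := ae_restrict_of_ae (s := Ycell d) hS3
  have hg0 : 0 ≤ᵐ[μ] g := by
    filter_upwards [hS3'] with y hy
    by_cases h : ξ₁ + V₁ y = ξ₂ + V₂ y
    · simp [g, h, mdot]
    · exact (hy _ _ h).le
  refine lt_of_le_of_ne (integral_nonneg_of_ae hg0) fun h0 => hne ?_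
  have hz := (integral_eq_zero_iff_of_nonneg_ae hg0 Ig).1 h0.symm
  have heq : ∀ᵐ y ∂μ, ξ₁ + V₁ y = ξ₂ + V₂ y := by
    filter_upwards [hS3', hz] with y hy hzy
    by_contra h
    exact (hy _ _ h).ne' hzy
  ext i j
  have hi : ∫ y, (ξ₁ i j + V₁ y i j) ∂μ = ∫ y, (ξ₂ i j + V₂ y i j) ∂μ := by
    refine integral_congr_ae ?_
    filter_upwards [heq] with y hy
    exact congrFun (congrFun hy i) j
  rw [integral_add (integrable_const _) (iV1 i j), integral_add (integrable_const _) (iV2 i j),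
    hV₁mean, hV₂mean] at hi
  have hr : μ.real univ = 1 := by
    simp [Measure.real, hμ, aux_vol]
  simpa [hr] using hi
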